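/- arXiv:2012.14170 — 5 statements merged into one kernel-verified Lean document; each statement's English description precedes it below -/
import Mathlib

section
/- Let a > 0, b ≥ 0, c > 0 and α > 0 with α ≠ 1. Then ∫₀^c (a + b·u)^(−α) du < (α/(α−1)) · c / (a^(α−1) · (a + b·c)) if α > 1, and ∫₀^c (a + b·u)^(−α) du < (1/(1−α)) · c / (a + b·c)^α if α < 1. -/
open MeasureTheory

/-- The antiderivative of `u ↦ (a + b * u) ^ (-α)`, evaluated on `[0, c]`. -/
theorem mul_integral_add_mul_rpow_neg {a b c : ℝ} (α : ℝ) (ha : 0 < a) (hb : 0 ≤ b)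
    (hc : 0 ≤ c) :
    b * (1 - α) * ∫ u in Set.Icc (0 : ℝ) c, (a + b * u) ^ (-α) =
      (a + b * c) ^ (1 - α) - a ^ (1 - α) := by
  have hpos : ∀ u ∈ Set.uIcc 0 c, a + b * u ≠ 0 := by
    intro u hu
    rw [Set.uIcc_of_le hc] at hu
    have := mul_nonneg hb hu.1
    positivity
  have hderiv : ∀ u ∈ Set.uIcc 0 c, HasDerivAt (fun u => (a + b * u) ^ (1 - α))
      (b * (1 - α) * (a + b * u) ^ (-α)) u := by
    intro u hu
    have h := (((hasDerivAt_id u).const_mul b).const_add a).rpow_const (p := 1 - α)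
      (Or.inl (hpos u hu))
    simpa [show 1 - α - 1 = -α by ring] using h
  have hcont : ContinuousOn (fun u => b * (1 - α) * (a + b * u) ^ (-α)) (Set.uIcc 0 c) :=
    continuousOn_const.mul
      (ContinuousOn.rpow_const (by fun_prop) fun u hu => Or.inl (hpos u hu))
  rw [integral_Icc_eq_integral_Ioc, ← intervalIntegral.integral_of_le hc,
    ← intervalIntegral.integral_const_mul,
    intervalIntegral.integral_eq_sub_of_hasDerivAt hderiv hcont.intervalIntegrable]
  simp

/-- Lemma (estimates of elementary integrals): for `a > 0`, `b ≥ 0`, `c > 0`, `α > 0`,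
`∫₀ᶜ (a + b u)^(-α) du` is bounded strictly by `(α/(α-1)) c / (a^(α-1) (a + b c))` when
`α > 1`, and by `(1/(1-α)) c / (a + b c)^α` when `α < 1`. -/
theorem stmt_0 (a b c α : ℝ) (ha : 0 < a) (hb : 0 ≤ b) (hc : 0 < c) (hα : 0 < α)
    (hα1 : α ≠ 1) :
    (1 < α → ∫ u in Set.Icc (0 : ℝ) c, (a + b * u) ^ (-α) <
      (α / (α - 1)) * c / (a ^ (α - 1) * (a + b * c))) ∧
    (α < 1 → ∫ u in Set.Icc (0 : ℝ) c, (a + b * u) ^ (-α) <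
      (1 / (1 - α)) * c / (a + b * c) ^ α) := by
  have hX : 0 < a + b * c := by positivity
  have key := mul_integral_add_mul_rpow_neg α ha hb hc.le
  rcases hb.eq_or_lt with rfl | hb'
  · have hI : ∫ u in Set.Icc (0 : ℝ) c, (a + 0 * u) ^ (-α) = c / a ^ α := by
      simp [hc.le, Real.rpow_neg ha.le, div_eq_mul_inv]
    rw [hI, zero_mul, add_zero]
    have hp : 0 < c / a ^ α := by positivity
    constructor
    · intro h
      rw [← Real.rpow_add_one ha.ne', sub_add_cancel, mul_div_assoc]
      exact lt_mul_of_one_lt_left hp ((one_lt_div (by linarith)).2 (by linarith))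
    · intro h
      rw [mul_div_assoc]
      exact lt_mul_of_one_lt_left hp ((one_lt_div (by linarith)).2 (by linarith))
  set I := ∫ u in Set.Icc (0 : ℝ) c, (a + b * u) ^ (-α)
  have haX : a < a + b * c := by
    have := mul_pos hb' hc
    linarith
  obtain ⟨X, hXdef⟩ : ∃ X, X = a + b * c := ⟨_, rfl⟩
  rw [← hXdef] at hX key haX ⊢
  constructor
  · intro h
    have ht : 0 < a / X := by positivity
    have hbern := one_add_mul_self_le_rpow_one_add (s := a / X - 1) (by linarith) h.le
    rw [add_sub_cancel] at hbern
    have hlt : (a / X) ^ α < (a / X) ^ (α - 1) :=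
      Real.rpow_lt_rpow_of_exponent_gt ht ((div_lt_one hX).2 haX) (by linarith)
    have hstrict := hbern.trans_lt hlt
    rw [Real.div_rpow ha.le hX.le] at hstrict
    rw [← neg_sub α 1, Real.rpow_neg ha.le, Real.rpow_neg hX.le] at key
    have hA : 0 < a ^ (α - 1) := by positivity
    have hP : 0 < X ^ (α - 1) := by positivity
    set A := a ^ (α - 1)
    set P := X ^ (α - 1)
    have hmul : b * ((α - 1) * (I * (A * X))) = X * (1 - A / P) := by
      have : b * ((α - 1) * I) = A⁻¹ - P⁻¹ := by linarith
      calc b * ((α - 1) * (I * (A * X))) = b * ((α - 1) * I) * (A * X) := by ring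
        _ = X * (1 - A / P) := by rw [this]; field_simp
    have hbound : X * (1 - A / P) < b * (α * c) := by
      calc X * (1 - A / P) < X * (α * (1 - a / X)) := by gcongr; linarith
        _ = α * (X - a) := by field_simp
        _ = b * (α * c) := by rw [hXdef]; ring
    have hα' : 0 < α - 1 := by linarith
    rw [lt_div_iff₀ (by positivity), div_mul_eq_mul_div, lt_div_iff₀ hα', mul_comm _ (α - 1)]
    exact lt_of_mul_lt_mul_left (hmul ▸ hbound) hb
  · intro h
    have hα' : 0 < 1 - α := by linarith
    have hlt : a < a ^ (1 - α) * X ^ α := by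
      calc a = a ^ (1 - α) * a ^ α := by rw [← Real.rpow_add ha]; simp
        _ < a ^ (1 - α) * X ^ α := by gcongr
    have hXX : X ^ (1 - α) * X ^ α = X := by rw [← Real.rpow_add hX]; simp
    have hmul : b * (I * X ^ α * (1 - α)) < b * c := by
      calc b * (I * X ^ α * (1 - α)) = b * (1 - α) * I * X ^ α := by ring
        _ = X - a ^ (1 - α) * X ^ α := by rw [key, sub_mul, hXX]
        _ < b * c := by linarith
    rw [lt_div_iff₀ (by positivity), one_div_mul_eq_div, lt_div_iff₀ hα']
    exact lt_of_mul_lt_mul_left hmul hb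
end

section
/- For every τ ∈ ℝ and z ∈ ℝ³, setting x⁰ = τ·⟨z⟩ and x⃗ = ⟨τ⟩·z, one has | |x⁰| − |x⃗| | + 1 ≥ (⟨τ⟩² + ⟨z⟩²) / (2·⟨τ⟩·⟨z⟩). -/
/-- For nonnegative `a, b` with `A² = a² + 1` and `B² = b² + 1`, the quantity `(A² + B²)/(2AB)`
is at most `|aB - bA| + 1`. -/
lemma div_two_mul_le_abs_sub_add_one {a b A B : ℝ} (ha : 0 ≤ a) (hb : 0 ≤ b) (hA : 0 < A)
    (hB : 0 < B) (hAa : A ^ 2 = a ^ 2 + 1) (hBb : B ^ 2 = b ^ 2 + 1) :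
    (A ^ 2 + B ^ 2) / (2 * A * B) ≤ |a * B - b * A| + 1 := by
  have haA : a ≤ A := by nlinarith
  have hbB : b ≤ B := by nlinarith
  have hsum : a * B + b * A ≤ 2 * A * B := by nlinarith
  have hdiff : |A ^ 2 - B ^ 2| = |a * B - b * A| * (a * B + b * A) := by
    have hnonneg : 0 ≤ a * B + b * A := by positivity
    rw [← abs_of_nonneg hnonneg, ← abs_mul]
    congr 1
    linear_combination B ^ 2 * hAa - A ^ 2 * hBb
  have hsq : (A - B) ^ 2 ≤ |A ^ 2 - B ^ 2| := by
    rcases le_total A B with h | h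
    · rw [abs_of_nonpos] <;> nlinarith
    · rw [abs_of_nonneg] <;> nlinarith
  have hmul := mul_le_mul_of_nonneg_left hsum (abs_nonneg (a * B - b * A))
  rw [div_le_iff₀ (by positivity)]
  linarith

/-- In the coordinates `x⁰ = τ⟨z⟩`, `x⃗ = ⟨τ⟩z`, one has
`||x⁰| − |x⃗|| + 1 ≥ (⟨τ⟩² + ⟨z⟩²)/(2⟨τ⟩⟨z⟩)`. -/
theorem stmt_2 (τ : ℝ) (z : EuclideanSpace ℝ (Fin 3)) :
    (Real.sqrt (τ ^ 2 + 1) ^ 2 + Real.sqrt (‖z‖ ^ 2 + 1) ^ 2) /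
        (2 * Real.sqrt (τ ^ 2 + 1) * Real.sqrt (‖z‖ ^ 2 + 1)) ≤
      |(|τ * Real.sqrt (‖z‖ ^ 2 + 1)| - ‖Real.sqrt (τ ^ 2 + 1) • z‖)| + 1 := by
  rw [abs_mul, abs_of_nonneg (Real.sqrt_nonneg (‖z‖ ^ 2 + 1)), norm_smul,
    Real.norm_of_nonneg (Real.sqrt_nonneg _), mul_comm (Real.sqrt (τ ^ 2 + 1)) ‖z‖]
  refine div_two_mul_le_abs_sub_add_one (abs_nonneg τ) (norm_nonneg z) (by positivity)
    (by positivity) ?_ (Real.sq_sqrt (by positivity))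
  rw [sq_abs, Real.sq_sqrt (by positivity)]
end

section
/- Fix τ₀ ∈ ℝ, r₀ ≥ 0, τ ∈ ℝ with τ ≥ τ₀, and z ∈ ℝ³. Then there exists z₀ ∈ ℝ³ with |z₀| ≤ r₀ such that τ·⟨z⟩ − τ₀·⟨z₀⟩ ≥ |⟨τ⟩·z − ⟨τ₀⟩·z₀| if and only if |z| ≤ r₀·(⟨τ₀⟩·⟨τ⟩ − τ₀·τ) + ⟨r₀⟩·(τ·⟨τ₀⟩ − ⟨τ⟩·τ₀). -/
/-- Every real is a `sinh`, and `cosh` is the corresponding value of `√(x ^ 2 + 1)`. -/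
theorem exists_sinh_eq_and_cosh_eq (x : ℝ) :
    ∃ a : ℝ, x = Real.sinh a ∧ Real.sqrt (x ^ 2 + 1) = Real.cosh a := by
  obtain ⟨a, rfl⟩ := Real.sinh_surjective x
  refine ⟨a, rfl, ?_⟩
  rw [← Real.cosh_sq, Real.sqrt_sq (Real.cosh_pos a).le]

/-- In hyperbolic coordinates, the difference of two points of the `1 + 1`-dimensional Minkowski
plane is future causal if and only if both null coordinates increase. -/
theorem abs_cosh_mul_sinh_sub_le_iff (a s b t : ℝ) :
    |Real.cosh a * Real.sinh s - Real.cosh b * Real.sinh t| ≤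
        Real.sinh a * Real.cosh s - Real.sinh b * Real.cosh t ↔
      b - t ≤ a - s ∧ b + t ≤ a + s := by
  rw [← Real.sinh_le_sinh (x := b - t), ← Real.sinh_le_sinh (x := b + t), Real.sinh_sub,
    Real.sinh_sub, Real.sinh_add, Real.sinh_add, abs_le]
  constructor <;> rintro ⟨h₁, h₂⟩ <;> constructor <;> linarith


/-- The point `x(τ,z) = (τ⟨z⟩, ⟨τ⟩z)` lies in the causal future of some point
`x(τ₀,z₀)` with `|z₀| ≤ r₀` if and only if
`|z| ≤ r₀(⟨τ₀⟩⟨τ⟩ − τ₀τ) + ⟨r₀⟩(τ⟨τ₀⟩ − ⟨τ⟩τ₀)`. -/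
theorem stmt_3 (τ₀ r₀ τ : ℝ) (hr₀ : 0 ≤ r₀) (hτ : τ₀ ≤ τ)
    (z : EuclideanSpace ℝ (Fin 3)) :
    (∃ z₀ : EuclideanSpace ℝ (Fin 3), ‖z₀‖ ≤ r₀ ∧
        ‖Real.sqrt (τ ^ 2 + 1) • z - Real.sqrt (τ₀ ^ 2 + 1) • z₀‖ ≤
          τ * Real.sqrt (‖z‖ ^ 2 + 1) - τ₀ * Real.sqrt (‖z₀‖ ^ 2 + 1)) ↔
      ‖z‖ ≤ r₀ * (Real.sqrt (τ₀ ^ 2 + 1) * Real.sqrt (τ ^ 2 + 1) - τ₀ * τ) +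
        Real.sqrt (r₀ ^ 2 + 1) *
          (τ * Real.sqrt (τ₀ ^ 2 + 1) - Real.sqrt (τ ^ 2 + 1) * τ₀) := by
  obtain ⟨a, rfl, ha⟩ := exists_sinh_eq_and_cosh_eq τ
  obtain ⟨b, rfl, hb⟩ := exists_sinh_eq_and_cosh_eq τ₀
  obtain ⟨ρ, rfl, hρ⟩ := exists_sinh_eq_and_cosh_eq r₀
  obtain ⟨s, hs, hs'⟩ := exists_sinh_eq_and_cosh_eq ‖z‖
  rw [Real.sinh_le_sinh] at hτ
  have hR : Real.sinh ρ * (Real.cosh b * Real.cosh a - Real.sinh b * Real.sinh a) +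
      Real.cosh ρ * (Real.sinh a * Real.cosh b - Real.cosh a * Real.sinh b) =
      Real.sinh (ρ + (a - b)) := by
    rw [Real.sinh_add, Real.cosh_sub, Real.sinh_sub]
    ring
  rw [ha, hb, hρ, hs', hR, hs, Real.sinh_le_sinh]
  constructor
  · rintro ⟨z₀, hz₀, h⟩
    obtain ⟨t, ht, ht'⟩ := exists_sinh_eq_and_cosh_eq ‖z₀‖
    rw [ht, Real.sinh_le_sinh] at hz₀
    have habs := (abs_norm_sub_norm_le (Real.cosh a • z) (Real.cosh b • z₀)).trans h
    rw [norm_smul, norm_smul, Real.norm_of_nonneg (Real.cosh_pos a).le,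
      Real.norm_of_nonneg (Real.cosh_pos b).le, ht', hs, ht, abs_cosh_mul_sinh_sub_le_iff] at habs
    linarith [habs.1]
  · intro h
    have key : ∀ c t : ℝ, 0 ≤ c → c * ‖z‖ = Real.sinh t → t ≤ ρ → b - t ≤ a - s → t ≤ s →
        ‖c • z‖ ≤ Real.sinh ρ ∧ ‖Real.cosh a • z - Real.cosh b • c • z‖ ≤
          Real.sinh a * Real.cosh s - Real.sinh b * Real.sqrt (‖c • z‖ ^ 2 + 1) := by
      intro c t hc hct htρ h₁ h₂
      have hn : ‖c • z‖ = Real.sinh t := by rw [norm_smul, Real.norm_of_nonneg hc, hct]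
      have hd : ‖Real.cosh a • z - Real.cosh b • c • z‖ =
          |Real.cosh a * Real.sinh s - Real.cosh b * Real.sinh t| := by
        rw [smul_smul, ← sub_smul, norm_smul, Real.norm_eq_abs, ← abs_norm z, ← abs_mul, ← hct,
          ← hs]
        congr 1
        ring
      rw [hd, hn, ← Real.cosh_sq, Real.sqrt_sq (Real.cosh_pos t).le]
      exact ⟨Real.sinh_le_sinh.2 htρ,
        (abs_cosh_mul_sinh_sub_le_iff a s b t).2 ⟨h₁, by linarith⟩⟩
    rcases le_or_gt s ρ with hsρ | hsρ
    · exact ⟨_, key 1 s zero_le_one (by rw [one_mul, hs]) hsρ (by linarith) le_rfl⟩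
    · have hz : ‖z‖ ≠ 0 := (hr₀.trans_lt ((Real.sinh_lt_sinh.2 hsρ).trans_eq hs.symm)).ne'
      exact ⟨_, key (Real.sinh ρ / ‖z‖) ρ (div_nonneg hr₀ (norm_nonneg z))
        (div_mul_cancel₀ _ hz) le_rfl (by linarith) hsρ.le⟩
end

section
/- Fix τ₀ ∈ ℝ, r₀ ≥ 0, τ ∈ ℝ with τ ≥ τ₀, and z, z₀ ∈ ℝ³ with |z₀| ≤ r₀. If τ·⟨z⟩ − τ₀·⟨z₀⟩ ≥ |⟨τ⟩·z − ⟨τ₀⟩·z₀|, then ⟨z⟩ ≤ ⟨r₀⟩·(⟨τ₀⟩ − τ₀)·(⟨τ⟩ + τ). -/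
/-- The hyperbolic form of the Japanese bracket: `⟨sinh a⟩ = cosh a`. -/
theorem sqrt_sinh_sq_add_one (a : ℝ) : Real.sqrt (Real.sinh a ^ 2 + 1) = Real.cosh a := by
  rw [← Real.cosh_sq, Real.sqrt_sq (Real.cosh_pos a).le]

theorem cosh_add_le_cosh_mul_exp (b : ℝ) {d : ℝ} (hd : 0 ≤ d) :
    Real.cosh (b + d) ≤ Real.cosh b * Real.exp d := by
  rw [Real.cosh_add, ← Real.cosh_add_sinh, mul_add]
  have := Real.sinh_nonneg_iff.2 hd
  have := Real.sinh_lt_cosh b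
  gcongr

/-- If `x(τ,z) = (τ⟨z⟩, ⟨τ⟩z)` lies in the causal future of `x(τ₀,z₀)` with
`|z₀| ≤ r₀`, then `⟨z⟩ ≤ ⟨r₀⟩(⟨τ₀⟩ − τ₀)(⟨τ⟩ + τ)`. -/
theorem stmt_4 (τ₀ r₀ τ : ℝ) (hr₀ : 0 ≤ r₀) (hτ : τ₀ ≤ τ)
    (z z₀ : EuclideanSpace ℝ (Fin 3)) (hz₀ : ‖z₀‖ ≤ r₀)
    (hcausal : ‖Real.sqrt (τ ^ 2 + 1) • z - Real.sqrt (τ₀ ^ 2 + 1) • z₀‖ ≤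
      τ * Real.sqrt (‖z‖ ^ 2 + 1) - τ₀ * Real.sqrt (‖z₀‖ ^ 2 + 1)) :
    Real.sqrt (‖z‖ ^ 2 + 1) ≤ Real.sqrt (r₀ ^ 2 + 1) *
      (Real.sqrt (τ₀ ^ 2 + 1) - τ₀) * (Real.sqrt (τ ^ 2 + 1) + τ) := by
  obtain ⟨a, rfl⟩ := Real.sinh_surjective τ
  obtain ⟨a₀, rfl⟩ := Real.sinh_surjective τ₀
  obtain ⟨b, hb⟩ := Real.sinh_surjective ‖z‖
  obtain ⟨b₀, hb₀⟩ := Real.sinh_surjective ‖z₀‖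
  have ha : a₀ ≤ a := Real.sinh_le_sinh.1 hτ
  have hb_nonneg : 0 ≤ b := Real.sinh_nonneg_iff.1 (hb ▸ norm_nonneg z)
  have htri := (norm_sub_norm_le _ _).trans hcausal
  rw [norm_smul, norm_smul, Real.norm_of_nonneg (Real.sqrt_nonneg _),
    Real.norm_of_nonneg (Real.sqrt_nonneg _), ← hb, ← hb₀] at htri
  simp only [sqrt_sinh_sq_add_one] at htri
  have hrapidity : b - a ≤ b₀ - a₀ := by
    rw [← Real.sinh_le_sinh, Real.sinh_sub, Real.sinh_sub]
    linarith
  have hb₀_le : Real.cosh b₀ ≤ Real.sqrt (r₀ ^ 2 + 1) := by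
    rw [← sqrt_sinh_sq_add_one, hb₀]
    gcongr
  rw [← hb]
  simp only [sqrt_sinh_sq_add_one]
  rw [Real.cosh_sub_sinh, Real.cosh_add_sinh, mul_assoc, ← Real.exp_add]
  calc Real.cosh b ≤ Real.cosh (b₀ + (-a₀ + a)) := by
        rw [Real.cosh_le_cosh, abs_of_nonneg hb_nonneg]
        exact le_trans (by linarith) (le_abs_self _)
    _ ≤ Real.cosh b₀ * Real.exp (-a₀ + a) := cosh_add_le_cosh_mul_exp b₀ (by linarith)
    _ ≤ Real.sqrt (r₀ ^ 2 + 1) * Real.exp (-a₀ + a) := by gcongr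
end

section
/- Let n ≥ 1, let L¹, L², L³ : ℝ³ → M_n(ℂ) be hermitian-matrix-valued functions of class C¹ such that sup_z ‖Lⁱ(z)‖/⟨z⟩ < ∞ and sup_z ‖∂_j Lⁱ(z)‖ < ∞ for all i, j, and let M : ℝ³ → M_n(ℂ) be a continuous hermitian-matrix-valued function with sup_z ‖M(z)‖/⟨z⟩² < ∞. Then there is a constant C₁ such that for every smooth compactly supported φ : ℝ³ → ℂⁿ, the L²-norm of hφ := −(i/2)·Σᵢ [Lⁱ·∂ᵢφ + ∂ᵢ(Lⁱφ)] + M·φ satisfies ‖hφ‖_{L²} ≤ C₁·‖h₀φ‖_{L²}, where h₀φ = (1/2)·(−Δφ + |z|²·φ). -/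
open MeasureTheory

noncomputable section

/-- The partial derivative `∂ᵢf` of a function on `ℝ³`. -/
def pd {F : Type*} [NormedAddCommGroup F] [NormedSpace ℝ F]
    (i : Fin 3) (f : EuclideanSpace ℝ (Fin 3) → F) (z : EuclideanSpace ℝ (Fin 3)) : F :=
  fderiv ℝ f z (EuclideanSpace.single i 1)

/-- The operator `h = (1/2)Σᵢ(Lⁱpᵢ + pᵢLⁱ) + M`, `pᵢ = −i∂ᵢ`, applied to `φ`:
`hφ = −(i/2)Σᵢ[Lⁱ∂ᵢφ + ∂ᵢ(Lⁱφ)] + Mφ`. -/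
def Hop {n : ℕ}
    (L : Fin 3 → EuclideanSpace ℝ (Fin 3) →
      (EuclideanSpace ℂ (Fin n) →L[ℂ] EuclideanSpace ℂ (Fin n)))
    (M : EuclideanSpace ℝ (Fin 3) →
      (EuclideanSpace ℂ (Fin n) →L[ℂ] EuclideanSpace ℂ (Fin n)))
    (φ : EuclideanSpace ℝ (Fin 3) → EuclideanSpace ℂ (Fin n))
    (z : EuclideanSpace ℝ (Fin 3)) : EuclideanSpace ℂ (Fin n) :=
  (-(Complex.I) / 2) • (∑ i : Fin 3, (L i z (pd i φ z) + pd i (fun w => L i w (φ w)) z))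
    + M z (φ z)

/-- The harmonic oscillator Hamiltonian `h₀φ = (1/2)(−Δφ + |z|²φ)`. -/
def H0op {n : ℕ} (φ : EuclideanSpace ℝ (Fin 3) → EuclideanSpace ℂ (Fin n))
    (z : EuclideanSpace ℝ (Fin 3)) : EuclideanSpace ℂ (Fin n) :=
  ((1 : ℝ) / 2) • (-(∑ i : Fin 3, pd i (pd i φ) z) + ‖z‖ ^ 2 • φ z)

local notation "ℝ³" => EuclideanSpace ℝ (Fin 3)

section PartialDerivatives

variable {F : Type*} [NormedAddCommGroup F] [NormedSpace ℝ F]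

lemma contDiff_pd {f : ℝ³ → F} {m k : ℕ∞} (i : Fin 3) (hf : ContDiff ℝ m f)
    (hk : (k : WithTop ℕ∞) + 1 ≤ m) : ContDiff ℝ k (pd i f) :=
  (hf.fderiv_right hk).clm_apply contDiff_const

lemma hasCompactSupport_pd {f : ℝ³ → F} (i : Fin 3) (hf : HasCompactSupport f) :
    HasCompactSupport (pd i f) :=
  hf.fderiv_apply ℝ (EuclideanSpace.single i 1)

/-- The integral of a partial derivative of a compactly supported function vanishes. -/
lemma integral_pd_eq_zero {f : ℝ³ → ℝ} (i : Fin 3) (hf : ContDiff ℝ 1 f)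
    (hc : HasCompactSupport f) : ∫ z, pd i f z = 0 := by
  have hi : Integrable fun z => fderiv ℝ f z (EuclideanSpace.single i 1) :=
    (contDiff_pd (m := 1) (k := 0) i hf
      (by norm_num)).continuous.integrable_of_hasCompactSupport (hasCompactSupport_pd i hc)
  have h := integral_mul_fderiv_eq_neg_fderiv_mul_of_integrable (μ := volume)
    (f := fun _ : ℝ³ => (1 : ℝ)) (g := f) (v := EuclideanSpace.single i 1)
    (by simp) (by simpa using hi)
    (by simpa using hf.continuous.integrable_of_hasCompactSupport hc)
    (fun _ _ => differentiableAt_const _) (fun z _ => (hf.differentiable (by norm_num)) z)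
  simpa [pd] using h

lemma pd_add {f g : ℝ³ → F} {i : Fin 3} {z : ℝ³} (hf : DifferentiableAt ℝ f z)
    (hg : DifferentiableAt ℝ g z) :
    pd i (fun w => f w + g w) z = pd i f z + pd i g z := by
  simp only [pd]; rw [fderiv_fun_add hf hg]; simp

lemma pd_mul {f g : ℝ³ → ℝ} {i : Fin 3} {z : ℝ³} (hf : DifferentiableAt ℝ f z)
    (hg : DifferentiableAt ℝ g z) :
    pd i (fun w => f w * g w) z = f z * pd i g z + g z * pd i f z := by
  simp only [pd]; rw [fderiv_fun_mul hf hg]; simp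

lemma pd_coord (i : Fin 3) (z : ℝ³) : pd i (fun w : ℝ³ => w i) z = 1 := by
  have h : HasFDerivAt (fun w : ℝ³ => w i) (EuclideanSpace.proj (𝕜 := ℝ) i) z :=
    (EuclideanSpace.proj (𝕜 := ℝ) i).hasFDerivAt
  simp [pd, h.fderiv]

lemma pd_norm_sq_add_const (i : Fin 3) (c : ℝ) (z : ℝ³) :
    pd i (fun w : ℝ³ => ‖w‖ ^ 2 + c) z = 2 * z i := by
  have h : HasFDerivAt (fun w : ℝ³ => ‖w‖ ^ 2 + c) (2 • innerSL ℝ z) z :=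
    (hasStrictFDerivAt_norm_sq z).hasFDerivAt.add_const c
  simp [pd, h.fderiv, EuclideanSpace.inner_single_right]

end PartialDerivatives

section HarmonicOscillator

variable {V : Type*} [NormedAddCommGroup V] [InnerProductSpace ℝ V]

lemma pd_inner {f g : ℝ³ → V} {i : Fin 3} {z : ℝ³} (hf : DifferentiableAt ℝ f z)
    (hg : DifferentiableAt ℝ g z) :
    pd i (fun w => inner ℝ (f w) (g w)) z = inner ℝ (f z) (pd i g z) + inner ℝ (pd i f z) (g z) :=
  fderiv_inner_apply ℝ hf hg _

/-- A vector field whose divergence is the defect in the weighted energy identity for the harmonic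
oscillator. -/
def virialField (φ : ℝ³ → V) (i : Fin 3) (z : ℝ³) : ℝ :=
  (‖z‖ ^ 2 + 3) * inner ℝ (pd i φ z) (φ z) + (1 / 3 * z i) * inner ℝ (φ z) (φ z)

lemma contDiff_virialField {φ : ℝ³ → V} (hφ : ContDiff ℝ 2 φ) (i : Fin 3) :
    ContDiff ℝ 1 (virialField φ i) := by
  have h1 : ContDiff ℝ 1 φ := hφ.of_le (by norm_num)
  have h2 : ContDiff ℝ 1 (pd i φ) := contDiff_pd (m := 2) (k := 1) i hφ (by norm_num)
  have h3 : ContDiff ℝ 1 (fun z : ℝ³ => z i) := (EuclideanSpace.proj (𝕜 := ℝ) i).contDiff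
  exact (((contDiff_norm_sq ℝ).add contDiff_const).mul (h2.inner ℝ h1)).add
    ((contDiff_const.mul h3).mul (h1.inner ℝ h1))

lemma hasCompactSupport_virialField {φ : ℝ³ → V} (hc : HasCompactSupport φ) (i : Fin 3) :
    HasCompactSupport (virialField φ i) :=
  hc.mono fun z hz h => hz (by simp [virialField, h])

lemma pd_virialField {φ : ℝ³ → V} (hφ : ContDiff ℝ 2 φ) (i : Fin 3) (z : ℝ³) :
    pd i (virialField φ i) z =
      (‖z‖ ^ 2 + 3) * (inner ℝ (pd i (pd i φ) z) (φ z) + ‖pd i φ z‖ ^ 2)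
        + 8 / 3 * (z i * inner ℝ (pd i φ z) (φ z)) + 1 / 3 * ‖φ z‖ ^ 2 := by
  have h1 : DifferentiableAt ℝ φ z := hφ.differentiable (by norm_num) z
  have h2 : DifferentiableAt ℝ (pd i φ) z :=
    (contDiff_pd (m := 2) (k := 1) i hφ (by norm_num)).differentiable (by norm_num) z
  have h3 : DifferentiableAt ℝ (fun z : ℝ³ => z i) z :=
    (EuclideanSpace.proj (𝕜 := ℝ) i).differentiableAt
  have h4 : DifferentiableAt ℝ (fun z : ℝ³ => ‖z‖ ^ 2 + 3) z :=
    ((hasStrictFDerivAt_norm_sq z).hasFDerivAt.add_const 3).differentiableAt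
  have h5 : DifferentiableAt ℝ (fun z : ℝ³ => 1 / 3 * z i) z := h3.const_mul _
  have h6 : pd i (fun w : ℝ³ => 1 / 3 * w i) z = 1 / 3 := by
    rw [pd_mul (differentiableAt_const _) h3, pd_coord]; simp [pd]
  unfold virialField
  rw [pd_add (h4.fun_mul (h2.inner ℝ h1)) (h5.fun_mul (h1.inner ℝ h1)), pd_mul h4 (h2.inner ℝ h1),
    pd_mul h5 (h1.inner ℝ h1), pd_inner h2 h1, pd_inner h1 h1, pd_norm_sq_add_const, h6,
    real_inner_self_eq_norm_sq, real_inner_self_eq_norm_sq, real_inner_comm (pd i φ z) (φ z)]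
  ring

/-- Pointwise form of the weighted energy estimate for the harmonic oscillator. -/
lemma weighted_energy_le {φ : ℝ³ → V} (hφ : ContDiff ℝ 2 φ) (z : ℝ³) :
    (‖z‖ ^ 2 + 1) * ∑ i, ‖pd i φ z‖ ^ 2 + (‖z‖ ^ 2 + 1) ^ 2 * ‖φ z‖ ^ 2 ≤
      36 * ‖((1 : ℝ) / 2) • (-(∑ i : Fin 3, pd i (pd i φ) z) + ‖z‖ ^ 2 • φ z)‖ ^ 2
        + 2 * ∑ i, pd i (virialField φ i) z := by
  set d := ((1 : ℝ) / 2) • (-(∑ i : Fin 3, pd i (pd i φ) z) + ‖z‖ ^ 2 • φ z) with hd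
  have hinner : 2 * inner ℝ d (φ z) =
      -(∑ i, inner ℝ (pd i (pd i φ) z) (φ z)) + ‖z‖ ^ 2 * ‖φ z‖ ^ 2 := by
    rw [hd, inner_smul_left, inner_add_left, inner_neg_left, sum_inner, inner_smul_left,
      real_inner_self_eq_norm_sq]
    simp only [conj_trivial]
    ring
  have hr : ‖z‖ ^ 2 = ∑ i, z i ^ 2 := EuclideanSpace.real_norm_sq_eq z
  have hcs : inner ℝ d (φ z) ≤ ‖d‖ * ‖φ z‖ := real_inner_le_norm _ _
  have hcross (i : Fin 3) : 0 ≤ 2 * ‖pd i φ z‖ ^ 2 + z i ^ 2 * ‖φ z‖ ^ 2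
      + 8 / 3 * (z i * inner ℝ (pd i φ z) (φ z)) := by
    have h := abs_real_inner_le_norm (pd i φ z) (φ z)
    have h' : |z i * inner ℝ (pd i φ z) (φ z)| ≤ |z i| * (‖pd i φ z‖ * ‖φ z‖) := by
      rw [abs_mul]; gcongr
    have h'' := (abs_le.1 h').1
    have e : z i ^ 2 = |z i| ^ 2 := (sq_abs _).symm
    rw [e]
    nlinarith [sq_nonneg (‖pd i φ z‖ * (4 / 3) - |z i| * ‖φ z‖), sq_nonneg ‖pd i φ z‖]
  have hsum := Finset.sum_nonneg (s := Finset.univ) fun i _ => hcross i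
  simp only [pd_virialField hφ]
  simp only [Finset.sum_add_distrib, ← Finset.mul_sum, ← Finset.sum_mul, ← hr] at hsum ⊢
  simp only [Finset.sum_const, Finset.card_univ, Fintype.card_fin, nsmul_eq_mul] at hsum ⊢
  set S := ∑ i, inner ℝ (pd i (pd i φ) z) (φ z)
  set P := ∑ i, ‖pd i φ z‖ ^ 2
  have hS : S = ‖z‖ ^ 2 * ‖φ z‖ ^ 2 - 2 * inner ℝ d (φ z) := by linarith
  have hP : 0 ≤ P := Finset.sum_nonneg fun _ _ => by positivity
  have hmain : 2 * (‖z‖ ^ 2 + 3) * inner ℝ d (φ z) ≤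
      18 * ‖d‖ ^ 2 + 1 / 2 * (‖z‖ ^ 2 + 1) ^ 2 * ‖φ z‖ ^ 2 := by
    have h0 : 0 ≤ ‖d‖ * ‖φ z‖ := by positivity
    calc 2 * (‖z‖ ^ 2 + 3) * inner ℝ d (φ z) ≤ 2 * (‖z‖ ^ 2 + 3) * (‖d‖ * ‖φ z‖) := by gcongr
      _ ≤ 6 * (‖z‖ ^ 2 + 1) * (‖d‖ * ‖φ z‖) :=
        mul_le_mul_of_nonneg_right (by linarith [sq_nonneg ‖z‖]) h0
      _ ≤ _ := by nlinarith [sq_nonneg (6 * ‖d‖ - (‖z‖ ^ 2 + 1) * ‖φ z‖)]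
  rw [hS]
  nlinarith [mul_nonneg (sq_nonneg ‖z‖) hP]

end HarmonicOscillator

lemma pd_clm_apply {V W : Type*} [NormedAddCommGroup V] [NormedSpace ℂ V]
    [NormedAddCommGroup W] [NormedSpace ℂ W] {A : ℝ³ → (V →L[ℂ] W)} {f : ℝ³ → V} {i : Fin 3}
    {z : ℝ³} (hA : DifferentiableAt ℝ A z) (hf : DifferentiableAt ℝ f z) :
    pd i (fun w => A w (f w)) z = A z (pd i f z) + pd i A z (f z) := by
  have h := ((ContinuousLinearMap.restrictScalarsL ℂ V W ℝ ℝ).hasFDerivAt.comp z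
    hA.hasFDerivAt).clm_apply hf.hasFDerivAt
  have h' : HasFDerivAt (fun w => A w (f w)) _ z := h
  simp [pd, h'.fderiv]

/-- Pointwise bound for a first order operator with linearly growing coefficients. -/
lemma norm_Hop_sq_le {n : ℕ}
    {L : Fin 3 → ℝ³ → (EuclideanSpace ℂ (Fin n) →L[ℂ] EuclideanSpace ℂ (Fin n))}
    {M : ℝ³ → (EuclideanSpace ℂ (Fin n) →L[ℂ] EuclideanSpace ℂ (Fin n))} {K : ℝ} {z : ℝ³}
    {φ : ℝ³ → EuclideanSpace ℂ (Fin n)} (hK : 0 ≤ K)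
    (hL : ∀ i, DifferentiableAt ℝ (L i) z) (hφ : DifferentiableAt ℝ φ z)
    (hLb : ∀ i, ‖L i z‖ ≤ K * Real.sqrt (‖z‖ ^ 2 + 1)) (hLd : ∀ i, ‖pd i (L i) z‖ ≤ K)
    (hMb : ‖M z‖ ≤ K * (‖z‖ ^ 2 + 1)) :
    ‖Hop L M φ z‖ ^ 2 ≤ 25 * K ^ 2 *
      ((‖z‖ ^ 2 + 1) * ∑ i, ‖pd i φ z‖ ^ 2 + (‖z‖ ^ 2 + 1) ^ 2 * ‖φ z‖ ^ 2) := by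
  set s := Real.sqrt (‖z‖ ^ 2 + 1)
  have hs : s ^ 2 = ‖z‖ ^ 2 + 1 := Real.sq_sqrt (by positivity)
  have hs0 : 0 ≤ s := Real.sqrt_nonneg _
  rw [← hs] at hMb ⊢
  have hs1 : 1 ≤ s ^ 2 := by rw [hs]; nlinarith [sq_nonneg ‖z‖]
  have hterm (i : Fin 3) : ‖L i z (pd i φ z) + pd i (fun w => L i w (φ w)) z‖ ≤
      2 * (K * s * ‖pd i φ z‖) + K * ‖φ z‖ := by
    rw [pd_clm_apply (hL i) hφ]
    have h1 : ‖L i z (pd i φ z)‖ ≤ K * s * ‖pd i φ z‖ :=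
      (L i z).le_of_opNorm_le (hLb i) _
    have h2 : ‖pd i (L i) z (φ z)‖ ≤ K * ‖φ z‖ := (pd i (L i) z).le_of_opNorm_le (hLd i) _
    have h3 := norm_add_le (L i z (pd i φ z)) (L i z (pd i φ z) + pd i (L i) z (φ z))
    have h4 := norm_add_le (L i z (pd i φ z)) (pd i (L i) z (φ z))
    linarith
  have hM : ‖M z (φ z)‖ ≤ K * s ^ 2 * ‖φ z‖ := (M z).le_of_opNorm_le hMb _
  have hbound : ‖Hop L M φ z‖ ≤ K * (s * ∑ i, ‖pd i φ z‖ + 5 / 2 * (s ^ 2 * ‖φ z‖)) := by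
    have h1 := norm_sum_le_of_le Finset.univ fun i _ => hterm i
    have h2 : ‖-Complex.I / 2‖ = 1 / 2 := by simp
    calc ‖Hop L M φ z‖ ≤ ‖-Complex.I / 2‖ *
          ‖∑ i : Fin 3, (L i z (pd i φ z) + pd i (fun w => L i w (φ w)) z)‖ + ‖M z (φ z)‖ := by
          rw [← norm_smul]; exact norm_add_le _ _
      _ ≤ 1 / 2 * (∑ i : Fin 3, (2 * (K * s * ‖pd i φ z‖) + K * ‖φ z‖))
          + K * s ^ 2 * ‖φ z‖ := by rw [h2]; gcongr
      _ = K * (s * ∑ i, ‖pd i φ z‖ + (3 / 2 * ‖φ z‖ + s ^ 2 * ‖φ z‖)) := by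
          simp only [Fin.sum_univ_three]; ring
      _ ≤ _ := by
          gcongr
          nlinarith [mul_le_mul_of_nonneg_right hs1 (norm_nonneg (φ z))]
  have hcs : (∑ i, ‖pd i φ z‖) ^ 2 ≤ 3 * ∑ i, ‖pd i φ z‖ ^ 2 := by
    simpa using sq_sum_le_card_mul_sum_sq (s := Finset.univ) (f := fun i => ‖pd i φ z‖)
  calc ‖Hop L M φ z‖ ^ 2
      ≤ (K * (s * ∑ i, ‖pd i φ z‖ + 5 / 2 * (s ^ 2 * ‖φ z‖))) ^ 2 := by gcongr
    _ = K ^ 2 * (s * ∑ i, ‖pd i φ z‖ + 5 / 2 * (s ^ 2 * ‖φ z‖)) ^ 2 := by ring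
    _ ≤ K ^ 2 * (25 * (s ^ 2 * ∑ i, ‖pd i φ z‖ ^ 2 + (s ^ 2) ^ 2 * ‖φ z‖ ^ 2)) := by
        gcongr
        have h1 := mul_le_mul_of_nonneg_left hcs (sq_nonneg s)
        have h2 : 0 ≤ s ^ 2 * ∑ i, ‖pd i φ z‖ ^ 2 := by positivity
        nlinarith [sq_nonneg (s * ∑ i, ‖pd i φ z‖ - 5 / 2 * (s ^ 2 * ‖φ z‖)),
          sq_nonneg (s ^ 2 * ‖φ z‖)]
    _ = _ := by ring

lemma continuous_H0op {n : ℕ} {φ : ℝ³ → EuclideanSpace ℂ (Fin n)} (hφ : ContDiff ℝ 2 φ) :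
    Continuous (H0op φ) := by
  have h (i : Fin 3) : Continuous (pd i (pd i φ)) :=
    (contDiff_pd (m := 1) (k := 0) i (contDiff_pd (m := 2) (k := 1) i hφ (by norm_num))
      (by norm_num)).continuous
  have h' := hφ.continuous
  unfold H0op
  fun_prop

lemma hasCompactSupport_H0op {n : ℕ} {φ : ℝ³ → EuclideanSpace ℂ (Fin n)}
    (hc : HasCompactSupport φ) : HasCompactSupport (H0op φ) := by
  refine hc.mono' fun z hz => ?_
  by_contra hzt
  have h0 : φ z = 0 := image_eq_zero_of_notMem_tsupport hzt
  have h1 (i : Fin 3) : pd i (pd i φ) z = 0 := by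
    have hsub (f : ℝ³ → EuclideanSpace ℂ (Fin n)) : tsupport (pd i f) ⊆ tsupport f :=
      tsupport_fderiv_apply_subset ℝ (EuclideanSpace.single i 1)
    exact image_eq_zero_of_notMem_tsupport fun h => hzt (hsub _ (hsub _ h))
  exact hz (by simp [H0op, h0, h1])

/-- Part (i) of the lemma: if `‖Lⁱ(z)‖ ≤ C⟨z⟩`, `‖∂ⱼLⁱ(z)‖ ≤ C` and `‖M(z)‖ ≤ C⟨z⟩²`,
then `‖hφ‖ ≤ C₁‖h₀φ‖` for all smooth compactly supported `φ`. -/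
theorem stmt_15 (n : ℕ) (hn : 1 ≤ n)
    (L : Fin 3 → EuclideanSpace ℝ (Fin 3) →
      (EuclideanSpace ℂ (Fin n) →L[ℂ] EuclideanSpace ℂ (Fin n)))
    (M : EuclideanSpace ℝ (Fin 3) →
      (EuclideanSpace ℂ (Fin n) →L[ℂ] EuclideanSpace ℂ (Fin n)))
    (hLherm : ∀ i z, IsSelfAdjoint (L i z))
    (hLsm : ∀ i, ContDiff ℝ 1 (L i))
    (hLb : ∃ CL : ℝ, ∀ i z, ‖L i z‖ ≤ CL * Real.sqrt (‖z‖ ^ 2 + 1))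
    (hLd : ∃ CL' : ℝ, ∀ i j z, ‖pd j (L i) z‖ ≤ CL')
    (hMherm : ∀ z, IsSelfAdjoint (M z))
    (hMc : Continuous M)
    (hMb : ∃ CM : ℝ, ∀ z, ‖M z‖ ≤ CM * (‖z‖ ^ 2 + 1)) :
    ∃ C₁ : ℝ, ∀ φ : EuclideanSpace ℝ (Fin 3) → EuclideanSpace ℂ (Fin n),
      ContDiff ℝ (⊤ : ℕ∞) φ → HasCompactSupport φ →
        Real.sqrt (∫ z, ‖Hop L M φ z‖ ^ 2) ≤
          C₁ * Real.sqrt (∫ z, ‖H0op φ z‖ ^ 2) := by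
  obtain ⟨CL, hCL⟩ := hLb
  obtain ⟨CL', hCL'⟩ := hLd
  obtain ⟨CM, hCM⟩ := hMb
  set K := max (max CL CL') (max CM 0)
  have hK1 : CL ≤ K := (le_max_left _ _).trans (le_max_left _ _)
  have hK2 : CL' ≤ K := (le_max_right _ _).trans (le_max_left _ _)
  have hK3 : CM ≤ K := (le_max_left _ _).trans (le_max_right _ _)
  have hK : 0 ≤ K := (le_max_right _ _).trans (le_max_right _ _)
  refine ⟨30 * K, fun φ hφ hc => ?_⟩
  have hφ2 : ContDiff ℝ 2 φ := hφ.of_le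
    (WithTop.coe_le_coe.2 (le_top : (2 : ℕ∞) ≤ ⊤))
  have hpt (z : EuclideanSpace ℝ (Fin 3)) : ‖Hop L M φ z‖ ^ 2 ≤
      25 * K ^ 2 * (36 * ‖H0op φ z‖ ^ 2 + 2 * ∑ i, pd i (virialField φ i) z) := by
    refine (norm_Hop_sq_le hK (fun i => (hLsm i).differentiable (by norm_num) z)
      (hφ2.differentiable (by norm_num) z) (fun i => (hCL i z).trans (by gcongr))
      (fun i => (hCL' i i z).trans hK2) ((hCM z).trans (by gcongr))).trans ?_
    exact mul_le_mul_of_nonneg_left (weighted_energy_le hφ2 z) (by positivity)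
  have hi1 : Integrable fun z => ‖H0op φ z‖ ^ 2 :=
    ((continuous_H0op hφ2).norm.pow 2).integrable_of_hasCompactSupport
      ((hasCompactSupport_H0op hc).mono fun z hz h => hz (by simp [h]))
  have hi2 (i : Fin 3) : Integrable (pd i (virialField φ i)) :=
    (contDiff_pd (m := 1) (k := 0) i (contDiff_virialField hφ2 i)
      (by norm_num)).continuous.integrable_of_hasCompactSupport
      (hasCompactSupport_pd i (hasCompactSupport_virialField hc i))
  have hi3 : Integrable fun z => ∑ i, pd i (virialField φ i) z :=
    integrable_finsetSum _ fun i _ => hi2 i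
  have hint : ∫ z, ‖Hop L M φ z‖ ^ 2 ≤ (30 * K) ^ 2 * ∫ z, ‖H0op φ z‖ ^ 2 := by
    calc ∫ z, ‖Hop L M φ z‖ ^ 2
        ≤ ∫ z, 25 * K ^ 2 * (36 * ‖H0op φ z‖ ^ 2 + 2 * ∑ i, pd i (virialField φ i) z) :=
          integral_mono_of_nonneg (.of_forall fun _ => by positivity)
            (((hi1.const_mul _).add (hi3.const_mul _)).const_mul _) (.of_forall hpt)
      _ = (30 * K) ^ 2 * ∫ z, ‖H0op φ z‖ ^ 2 := by
          rw [integral_const_mul, integral_add (hi1.const_mul _) (hi3.const_mul _),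
            integral_const_mul, integral_const_mul, integral_finsetSum _ fun i _ => hi2 i]
          simp only [integral_pd_eq_zero _ (contDiff_virialField hφ2 _)
            (hasCompactSupport_virialField hc _), Finset.sum_const_zero]
          ring
  calc Real.sqrt (∫ z, ‖Hop L M φ z‖ ^ 2)
      ≤ Real.sqrt ((30 * K) ^ 2 * ∫ z, ‖H0op φ z‖ ^ 2) := Real.sqrt_le_sqrt hint
    _ = 30 * K * Real.sqrt (∫ z, ‖H0op φ z‖ ^ 2) := by
        rw [Real.sqrt_mul (by positivity), Real.sqrt_sq (by positivity)]

end
end
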